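/- arXiv:2505.13867 — 2 statements merged into one kernel-verified Lean document; each statement's English description precedes it below -/
import Mathlib

section
/- Let E be a normed real vector space with its Borel σ-algebra and F a normed vector space. Let D, P, Q be probability measures on E whose supports are contained in the closed ball of radius R₁ ≥ 0 centered at 0. Let ψ : E → F be Lipschitz with constant R₂ ≥ 0 with ψ(0) = 0, and let 𝓕 be a nonempty collection of functions η : E → F, each Lipschitz with constant R₂ and satisfying η(0) = 0. For a probability measure μ and η ∈ 𝓕 define the risk L_μ(η) = ∫ ‖ψ(A) − η(A)‖² dμ(A) (these integrals are finite since the integrand is bounded by 4·R₁²·R₂² on the supports). Then for every η* ∈ 𝓕, L_Q(η*) ≤ L_D(η*) + sup_{η ∈ 𝓕} |L_D(η) − L_P(η)| + 8·R₁·R₂² · sup{ |∫ h dP − ∫ h dQ| : h : E → ℝ Lipschitz with constant 1 }. -/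
open MeasureTheory

section KantorovichRubinstein

variable {E : Type*} [NormedAddCommGroup E] [MeasurableSpace E]

theorem ae_norm_le_of_measure_compl_closedBall_eq_zero {μ : Measure E} {R : ℝ}
    (hμ : μ (Metric.closedBall (0 : E) R)ᶜ = 0) : ∀ᵐ x ∂μ, ‖x‖ ≤ R := by
  have h : ∀ᵐ x ∂μ, x ∈ Metric.closedBall (0 : E) R := hμ
  simpa using h

theorem LipschitzWith.ae_norm_sub_apply_zero_le {μ : Measure E} {R : ℝ}
    (hμ : ∀ᵐ x ∂μ, ‖x‖ ≤ R) {h : E → ℝ} (hh : LipschitzWith 1 h) :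
    ∀ᵐ x ∂μ, ‖h x - h 0‖ ≤ R := by
  filter_upwards [hμ] with x hx
  have := hh.norm_sub_le x 0
  simp only [NNReal.coe_one, one_mul, sub_zero] at this
  exact this.trans hx

variable [BorelSpace E]

theorem LipschitzWith.abs_integral_sub_apply_zero_le {μ : Measure E} [IsProbabilityMeasure μ]
    {R : ℝ} (hμ : ∀ᵐ x ∂μ, ‖x‖ ≤ R) {h : E → ℝ} (hh : LipschitzWith 1 h) :
    |(∫ x, h x ∂μ) - h 0| ≤ R := by
  have hb := hh.ae_norm_sub_apply_zero_le hμ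
  have hi : Integrable (fun x => h x - h 0) μ :=
    .of_bound (hh.continuous.sub continuous_const).measurable.aestronglyMeasurable R hb
  have hi' : Integrable h μ := by
    simpa [Pi.add_def] using hi.add (integrable_const (h 0))
  have := norm_integral_le_of_norm_le_const hb
  rw [integral_sub hi' (integrable_const _)] at this
  simpa using this

theorem bddAbove_abs_integral_sub_integral {P Q : Measure E} [IsProbabilityMeasure P]
    [IsProbabilityMeasure Q] {R : ℝ} (hP : ∀ᵐ x ∂P, ‖x‖ ≤ R) (hQ : ∀ᵐ x ∂Q, ‖x‖ ≤ R) :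
    BddAbove {d : ℝ | ∃ h : E → ℝ, LipschitzWith 1 h ∧
      d = |(∫ x, h x ∂P) - ∫ x, h x ∂Q|} := by
  refine ⟨R + R, ?_⟩
  rintro _ ⟨h, hh, rfl⟩
  have h₁ := abs_le.1 (hh.abs_integral_sub_apply_zero_le hP)
  have h₂ := abs_le.1 (hh.abs_integral_sub_apply_zero_le hQ)
  exact abs_le.2 ⟨by linarith, by linarith⟩

theorem abs_integral_sub_integral_le_mul_sSup {P Q : Measure E} [IsProbabilityMeasure P]
    [IsProbabilityMeasure Q] {R : ℝ} (hP : ∀ᵐ x ∂P, ‖x‖ ≤ R) (hQ : ∀ᵐ x ∂Q, ‖x‖ ≤ R)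
    {C : ℝ} (hC : 0 ≤ C) {f : E → ℝ} (hf : ∀ x y, |f x - f y| ≤ C * ‖x - y‖) :
    |(∫ x, f x ∂P) - ∫ x, f x ∂Q| ≤ C * sSup {d : ℝ | ∃ h : E → ℝ, LipschitzWith 1 h ∧
      d = |(∫ x, h x ∂P) - ∫ x, h x ∂Q|} := by
  rcases hC.eq_or_lt with rfl | hC
  · have hconst : f = fun _ => f 0 := by
      funext x
      have := hf x 0
      rw [zero_mul] at this
      exact sub_eq_zero.1 (abs_eq_zero.1 (this.antisymm (abs_nonneg _)))
    rw [hconst]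
    simp
  · have hlip : LipschitzWith 1 (fun x => C⁻¹ * f x) := by
      refine LipschitzWith.of_dist_le_mul fun x y => ?_
      rw [Real.dist_eq, ← mul_sub, abs_mul, abs_of_pos (inv_pos.2 hC), dist_eq_norm,
        NNReal.coe_one, one_mul, inv_mul_le_iff₀ hC]
      exact hf x y
    have := le_csSup (bddAbove_abs_integral_sub_integral hP hQ) ⟨_, hlip, rfl⟩
    rwa [integral_const_mul, integral_const_mul, ← mul_sub, abs_mul,
      abs_of_pos (inv_pos.2 hC), inv_mul_le_iff₀ hC] at this

end KantorovichRubinstein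

theorem abs_min_sq_sub_min_sq_le {a b M : ℝ} (ha : 0 ≤ a) (hb : 0 ≤ b) (hM : 0 ≤ M) :
    |min a M ^ 2 - min b M ^ 2| ≤ 2 * M * |a - b| := by
  have h₁ : |min a M - min b M| ≤ |a - b| := by
    simpa using abs_min_sub_min_le_max a M b M
  have h₂ : |min a M + min b M| ≤ 2 * M := by
    rw [abs_of_nonneg (add_nonneg (le_min ha hM) (le_min hb hM))]
    linarith [min_le_right a M, min_le_right b M]
  rw [sq_sub_sq, abs_mul]
  gcongr

theorem norm_sub_sub_norm_sub_le {E F : Type*} [NormedAddCommGroup E] [NormedAddCommGroup F]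
    {K : ℝ} {ψ η : E → F} (hψ : ∀ x y : E, ‖ψ x - ψ y‖ ≤ K * ‖x - y‖)
    (hη : ∀ x y : E, ‖η x - η y‖ ≤ K * ‖x - y‖) (x y : E) :
    |‖ψ x - η x‖ - ‖ψ y - η y‖| ≤ 2 * K * ‖x - y‖ := by
  calc |‖ψ x - η x‖ - ‖ψ y - η y‖| ≤ ‖(ψ x - η x) - (ψ y - η y)‖ := abs_norm_sub_norm_le _ _
    _ = ‖(ψ x - ψ y) - (η x - η y)‖ := by congr 1; abel
    _ ≤ ‖ψ x - ψ y‖ + ‖η x - η y‖ := norm_sub_le _ _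
    _ ≤ 2 * K * ‖x - y‖ := by linarith [hψ x y, hη x y]

/-- Per-path core of the generalization error bound (Theorem 1): the test risk of
the trained extrapolator is bounded by the training loss, the intra-environment
generalization gap, and `C·W₁(P,Q)` with `C = 8·R₁·R₂²`, where the Wasserstein-1
distance is written in Kantorovich–Rubinstein dual form. -/
theorem stmt_7 {E F : Type*} [NormedAddCommGroup E] [NormedSpace ℝ E]
    [MeasurableSpace E] [BorelSpace E]
    [NormedAddCommGroup F] [NormedSpace ℝ F]
    (R₁ R₂ : ℝ) (hR₁ : 0 ≤ R₁) (hR₂ : 0 ≤ R₂)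
    (D P Q : Measure E) [IsProbabilityMeasure D] [IsProbabilityMeasure P]
    [IsProbabilityMeasure Q]
    (hD : D (Metric.closedBall (0 : E) R₁)ᶜ = 0)
    (hP : P (Metric.closedBall (0 : E) R₁)ᶜ = 0)
    (hQ : Q (Metric.closedBall (0 : E) R₁)ᶜ = 0)
    (ψ : E → F) (hψ : ∀ x y : E, ‖ψ x - ψ y‖ ≤ R₂ * ‖x - y‖) (hψ0 : ψ 0 = 0)
    (𝓕 : Set (E → F)) (h𝓕ne : 𝓕.Nonempty)
    (h𝓕Lip : ∀ η ∈ 𝓕, ∀ x y : E, ‖η x - η y‖ ≤ R₂ * ‖x - y‖)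
    (h𝓕0 : ∀ η ∈ 𝓕, η 0 = 0)
    (L : Measure E → (E → F) → ℝ)
    (hL : ∀ (μ : Measure E) (η : E → F), L μ η = ∫ A, ‖ψ A - η A‖ ^ 2 ∂μ)
    (ηstar : E → F) (hηstar : ηstar ∈ 𝓕) :
    L Q ηstar ≤ L D ηstar + sSup ((fun η => |L D η - L P η|) '' 𝓕) +
      8 * R₁ * R₂ ^ 2 * sSup {d : ℝ | ∃ h : E → ℝ, LipschitzWith 1 h ∧
        d = |(∫ x, h x ∂P) - ∫ x, h x ∂Q|} := by
  have hD' := ae_norm_le_of_measure_compl_closedBall_eq_zero hD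
  have hP' := ae_norm_le_of_measure_compl_closedBall_eq_zero hP
  have hQ' := ae_norm_le_of_measure_compl_closedBall_eq_zero hQ
  set M : ℝ := 2 * R₁ * R₂ with hMdef
  have hM : 0 ≤ M := by positivity
  have hbound : ∀ η ∈ 𝓕, ∀ x : E, ‖x‖ ≤ R₁ → ‖ψ x - η x‖ ≤ M := by
    intro η hη x hx
    have := le_of_abs_le (norm_sub_sub_norm_sub_le hψ (h𝓕Lip η hη) x 0)
    simp only [hψ0, h𝓕0 η hη, sub_zero, norm_zero] at this
    nlinarith
  have hrisk : ∀ (μ : Measure E) [IsProbabilityMeasure μ], (∀ᵐ x ∂μ, ‖x‖ ≤ R₁) →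
      ∀ η ∈ 𝓕, |L μ η| ≤ M ^ 2 := by
    intro μ _ hμ η hη
    rw [hL]
    have hb : ∀ᵐ x ∂μ, ‖‖ψ x - η x‖ ^ 2‖ ≤ M ^ 2 := by
      filter_upwards [hμ] with x hx
      rw [Real.norm_of_nonneg (by positivity)]
      exact pow_le_pow_left₀ (norm_nonneg _) (hbound η hη x hx) 2
    simpa using norm_integral_le_of_norm_le_const hb
  have htrunc : ∀ (μ : Measure E), (∀ᵐ x ∂μ, ‖x‖ ≤ R₁) →
      L μ ηstar = ∫ x, min ‖ψ x - ηstar x‖ M ^ 2 ∂μ := by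
    intro μ hμ
    rw [hL]
    refine integral_congr_ae ?_
    filter_upwards [hμ] with x hx
    rw [min_eq_left (hbound ηstar hηstar x hx)]
  have hintra : |L D ηstar - L P ηstar| ≤ sSup ((fun η => |L D η - L P η|) '' 𝓕) := by
    refine le_csSup ⟨M ^ 2 + M ^ 2, ?_⟩ ⟨ηstar, hηstar, rfl⟩
    rintro _ ⟨η, hη, rfl⟩
    exact (abs_sub _ _).trans (add_le_add (hrisk D hD' η hη) (hrisk P hP' η hη))
  have hinter := abs_integral_sub_integral_le_mul_sSup hP' hQ'
    (C := 8 * R₁ * R₂ ^ 2) (by positivity)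
    (f := fun x => min ‖ψ x - ηstar x‖ M ^ 2) fun x y => by
      calc _ ≤ 2 * M * |‖ψ x - ηstar x‖ - ‖ψ y - ηstar y‖| :=
            abs_min_sq_sub_min_sq_le (norm_nonneg _) (norm_nonneg _) hM
        _ ≤ 2 * M * (2 * R₂ * ‖x - y‖) := by
            gcongr
            exact norm_sub_sub_norm_sub_le hψ (h𝓕Lip ηstar hηstar) x y
        _ = 8 * R₁ * R₂ ^ 2 * ‖x - y‖ := by rw [hMdef]; ring
  rw [← htrunc P hP', ← htrunc Q hQ'] at hinter
  linarith [neg_le_of_abs_le hinter, neg_le_of_abs_le hintra]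
end

section
/- Fix antenna numbers N_h, N_v ≥ 1, a number of subcarriers K ≥ 1, a start frequency f₁ ∈ ℝ, a subcarrier spacing Δf ≠ 0, and oversampling factors O_h, O_v, O_d ≥ 1. For α ∈ ℂ, ω_h, ω_v ∈ ℝ, τ ∈ ℝ, define the path response matrix R(α, ω_h, ω_v, τ) ∈ ℂ^{(N_h·N_v) × K} with entries R[(n₁,n₂), k] = α · exp(−2πi f₁ τ) · exp(i (n₁ ω_h + n₂ ω_v)) · exp(−2πi k Δf τ) for n₁ ∈ {0,…,N_h−1}, n₂ ∈ {0,…,N_v−1}, k ∈ {0,…,K−1}. For integers m₁, m₂, m₃, define the phase-adjusting matrix U(m₁,m₂,m₃) with entries U[(n₁,n₂), k] = exp(−2πi (m₁ n₁/(O_h N_h) + m₂ n₂/(O_v N_v))) · exp(2πi m₃ k/(O_d K)). Then, with s = m₃/(O_d K Δf), the Hadamard product satisfies U(m₁,m₂,m₃) ⊙ R(α, ω_h, ω_v, τ) = R(α·exp(−2πi f₁ s), ω_h − 2π m₁/(O_h N_h), ω_v − 2π m₂/(O_v N_v), τ − s). -/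
open Matrix

/-- Single-path response matrix of an `N_h × N_v` uniform planar array over `K`
subcarriers with start frequency `f₁` and subcarrier spacing `Δf`:
`R[(n₁,n₂),k] = α·exp(−2πi f₁ τ)·exp(i(n₁ω_h + n₂ω_v))·exp(−2πi k Δf τ)`. -/
noncomputable def pathResp (Nh Nv K : ℕ) (f₁ Δf : ℝ) (α : ℂ) (ωh ωv τ : ℝ) :
    Matrix (Fin Nh × Fin Nv) (Fin K) ℂ := fun p k =>
  α * Complex.exp (((-(2 * Real.pi * f₁ * τ) : ℝ) : ℂ) * Complex.I)
    * Complex.exp ((((p.1.val : ℝ) * ωh + (p.2.val : ℝ) * ωv : ℝ) : ℂ) * Complex.I)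
    * Complex.exp (((-(2 * Real.pi * (k.val : ℝ) * Δf * τ) : ℝ) : ℂ) * Complex.I)

/-- Phase-adjusting matrix for path alignment with integer shifts `m₁, m₂, m₃`
and oversampling factors `O_h, O_v, O_d`:
`U[(n₁,n₂),k] = exp(−2πi(m₁n₁/(O_hN_h) + m₂n₂/(O_vN_v)))·exp(2πi m₃k/(O_dK))`. -/
noncomputable def phaseAdjust (Nh Nv K : ℕ) (Oh Ov Od : ℕ) (m₁ m₂ m₃ : ℤ) :
    Matrix (Fin Nh × Fin Nv) (Fin K) ℂ := fun p k =>
  Complex.exp (((-(2 * Real.pi * ((m₁ : ℝ) * (p.1.val : ℝ) / ((Oh : ℝ) * (Nh : ℝ))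
        + (m₂ : ℝ) * (p.2.val : ℝ) / ((Ov : ℝ) * (Nv : ℝ)))) : ℝ) : ℂ) * Complex.I)
    * Complex.exp (((2 * Real.pi * (m₃ : ℝ) * (k.val : ℝ) / ((Od : ℝ) * (K : ℝ)) : ℝ) : ℂ)
        * Complex.I)

/-- Measured-band path-alignment identity (eq. (47)): elementwise phase
adjustment of a single-path response is equivalent to shifting the spatial
frequencies and the delay of the path, with an accompanying phase shift of the
complex gain. -/
theorem stmt_12 (Nh Nv K : ℕ) (hNh : 1 ≤ Nh) (hNv : 1 ≤ Nv) (hK : 1 ≤ K)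
    (f₁ Δf : ℝ) (hΔf : Δf ≠ 0) (Oh Ov Od : ℕ) (hOh : 1 ≤ Oh) (hOv : 1 ≤ Ov)
    (hOd : 1 ≤ Od) (α : ℂ) (ωh ωv τ : ℝ) (m₁ m₂ m₃ : ℤ) :
    phaseAdjust Nh Nv K Oh Ov Od m₁ m₂ m₃ ⊙ pathResp Nh Nv K f₁ Δf α ωh ωv τ =
      pathResp Nh Nv K f₁ Δf
        (α * Complex.exp (((-(2 * Real.pi * f₁ *
            ((m₃ : ℝ) / ((Od : ℝ) * (K : ℝ) * Δf))) : ℝ) : ℂ) * Complex.I))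
        (ωh - 2 * Real.pi * (m₁ : ℝ) / ((Oh : ℝ) * (Nh : ℝ)))
        (ωv - 2 * Real.pi * (m₂ : ℝ) / ((Ov : ℝ) * (Nv : ℝ)))
        (τ - (m₃ : ℝ) / ((Od : ℝ) * (K : ℝ) * Δf)) := by
  have hOd' : (Od : ℝ) ≠ 0 := by positivity
  have hK' : (K : ℝ) ≠ 0 := by positivity
  have exp_regroup : ∀ a b c d e a' b' c' d' : ℝ, a + b + c + d + e = a' + b' + c' + d' →
      Complex.exp (a * Complex.I) * Complex.exp (b * Complex.I) *
        (α * Complex.exp (c * Complex.I) * Complex.exp (d * Complex.I) *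
          Complex.exp (e * Complex.I)) =
      α * Complex.exp (a' * Complex.I) * Complex.exp (b' * Complex.I) *
        Complex.exp (c' * Complex.I) * Complex.exp (d' * Complex.I) := by
    intro a b c d e a' b' c' d' h
    rw [mul_assoc α, mul_assoc α, mul_left_comm _ α]
    simp only [mul_assoc, ← Complex.exp_add, ← add_mul, ← Complex.ofReal_add, ← add_assoc, h]
  ext p k
  simp only [Matrix.hadamard_apply, phaseAdjust, pathResp]
  apply exp_regroup
  field_simp
  ring
end
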